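/- Let n ≥ 2 and let A ⊆ Fin n × Fin n be an arc set with the intermediate property: (1) every (i,j) ∈ A satisfies (j : ℕ) < (i : ℕ) (so the directed graph is acyclic with arcs going downward); (2) for every i with (i : ℕ)+1 < n, the arc (i+1, i) belongs to A; (3) whenever (j,i) ∈ A and (i : ℕ)+1 < (j : ℕ), also (j, i+1) ∈ A. Let b : Fin n → ℝ be any supply vector and let P = { x : Fin n → Fin n → ℝ | x i j ≥ 0 for all i j, x i j = 0 whenever (i,j) ∉ A, and for every node i, ∑_j x i j − ∑_j x j i = b i } be the singly-capacitated network flow polytope of this graph. Then any two extreme points of P are joined by a path in the graph G(P) of length at most 2 · Set.ncard A. -/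

import Mathlib

open scoped BigOperators

noncomputable section

/-- Adjacency in the graph of a convex set `P`: two distinct extreme points whose closed
segment is a face of `P`. -/
def PolyAdj {E : Type*} [AddCommGroup E] [Module ℝ E] (P : Set E) (a b : E) : Prop :=
  a ≠ b ∧ a ∈ Set.extremePoints ℝ P ∧ b ∈ Set.extremePoints ℝ P ∧
    IsExtreme ℝ P (segment ℝ a b)

/-- A path of length `L` in the graph of `P` from `a` to `b`. -/
def HasPathOfLength {E : Type*} [AddCommGroup E] [Module ℝ E] (P : Set E) (a b : E)
    (L : ℕ) : Prop :=
  ∃ f : ℕ → E, f 0 = a ∧ f L = b ∧ ∀ i < L, PolyAdj P (f i) (f (i + 1))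

/-- The singly-capacitated network flow polytope on node set `Fin n` with arc set `A` and
supply vector `b`. -/
def flowPolytope (n : ℕ) (A : Set (Fin n × Fin n)) (b : Fin n → ℝ) :
    Set (Fin n → Fin n → ℝ) :=
  {x | (∀ i j, 0 ≤ x i j) ∧ (∀ i j, (i, j) ∉ A → x i j = 0) ∧
    (∀ i, (∑ j, x i j) - (∑ j, x j i) = b i)}

/-- The graph of a convex set, as a simple graph on the ambient space. -/
def polyGraph {E : Type*} [AddCommGroup E] [Module ℝ E] (P : Set E) : SimpleGraph E where
  Adj := PolyAdj P
  symm := ⟨fun a b h => ⟨h.1.symm, h.2.2.1, h.2.1, by rw [segment_symm]; exact h.2.2.2⟩⟩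
  loopless := ⟨fun _ h => h.1 rfl⟩

theorem hasPathOfLength_of_walk {E : Type*} [AddCommGroup E] [Module ℝ E] {P : Set E} {a b : E}
    (w : (polyGraph P).Walk a b) : HasPathOfLength P a b w.length :=
  ⟨w.getVert, w.getVert_zero, w.getVert_length, fun _ hi => w.adj_getVert_succ hi⟩

section

variable {n : ℕ} {A F : Set (Fin n × Fin n)} {b : Fin n → ℝ} {x y c : Fin n → Fin n → ℝ}

/-- A circulation: at each node the outflow equals the inflow. -/
def IsCirculation (c : Fin n → Fin n → ℝ) : Prop :=
  ∀ i, (∑ j, c i j) - (∑ j, c j i) = 0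

/-- The flow vanishes on all arcs outside `F`. -/
def SupportedOn (F : Set (Fin n × Fin n)) (c : Fin n → Fin n → ℝ) : Prop :=
  ∀ i j, (i, j) ∉ F → c i j = 0

/-- The arc set `F` is an (undirected) forest, phrased via circulations. -/
def IsForest (F : Set (Fin n × Fin n)) : Prop :=
  ∀ c, IsCirculation c → SupportedOn F c → c = 0

theorem IsCirculation.smul (hc : IsCirculation c) (t : ℝ) : IsCirculation (t • c) := by
  intro i
  simp only [Pi.smul_apply, smul_eq_mul, ← Finset.mul_sum, ← mul_sub, hc i, mul_zero]

theorem IsCirculation.sub {d : Fin n → Fin n → ℝ} (hc : IsCirculation c) (hd : IsCirculation d) :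
    IsCirculation (c - d) := by
  intro i
  have h1 := hc i
  have h2 := hd i
  simp only [Pi.sub_apply, Finset.sum_sub_distrib]
  linarith

theorem isCirculation_sub_of_mem (hx : x ∈ flowPolytope n A b) (hy : y ∈ flowPolytope n A b) :
    IsCirculation (x - y) := by
  intro i
  have h1 := hx.2.2 i
  have h2 := hy.2.2 i
  simp only [Pi.sub_apply, Finset.sum_sub_distrib]
  linarith

theorem add_smul_mem_flowPolytope (hx : x ∈ flowPolytope n A b) (hc : IsCirculation c)
    (hcA : SupportedOn A c) {t : ℝ} (h : ∀ i j, 0 ≤ x i j + t * c i j) :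
    x + t • c ∈ flowPolytope n A b := by
  refine ⟨h, fun i j hij => ?_, fun i => ?_⟩
  · simp [hx.2.1 i j hij, hcA i j hij]
  · have h1 := hx.2.2 i
    have h2 := hc.smul t i
    simp only [Pi.add_apply, Finset.sum_add_distrib]
    linarith

/-- A point of the flow polytope on a segment with endpoints in the polytope can vanish on an arc
only if the endpoints do. -/
theorem eq_zero_of_mem_openSegment {u v z : Fin n → Fin n → ℝ} (hu : u ∈ flowPolytope n A b)
    (hv : v ∈ flowPolytope n A b) (hz : z ∈ openSegment ℝ u v) {i j : Fin n} (h : z i j = 0) :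
    u i j = 0 := by
  obtain ⟨p, q, hp, hq, -, rfl⟩ := hz
  have h1 := hu.1 i j
  have h2 := hv.1 i j
  simp only [Pi.add_apply, Pi.smul_apply, smul_eq_mul] at h
  have h3 := mul_nonneg hp.le h1
  have h4 := mul_nonneg hq.le h2
  have h5 : p * u i j = 0 := by linarith
  exact (mul_eq_zero.1 h5).resolve_left hp.ne'

theorem mem_extremePoints_of_isForest (hF : IsForest F) (hx : x ∈ flowPolytope n A b)
    (hxF : SupportedOn F x) : x ∈ Set.extremePoints ℝ (flowPolytope n A b) := by
  refine ⟨hx, fun u hu v hv huv => ?_⟩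
  refine sub_eq_zero.1 (hF _ (isCirculation_sub_of_mem hu hx) fun i j hij => ?_)
  simp [hxF i j hij, eq_zero_of_mem_openSegment hu hv huv (hxF i j hij)]

theorem isForest_support_of_mem_extremePoints
    (hx : x ∈ Set.extremePoints ℝ (flowPolytope n A b)) : IsForest {a | x a.1 a.2 ≠ 0} := by
  intro c hc hcx
  have hcx' : ∀ i j, x i j = 0 → c i j = 0 := fun i j h => hcx i j (by simpa using h)
  obtain ⟨t, ht, hle⟩ : ∃ t : ℝ, 0 < t ∧ ∀ i j, t * |c i j| ≤ x i j := by
    have key : ∀ᶠ t in nhdsWithin (0 : ℝ) (Set.Ioi 0), ∀ i j, t * |c i j| ≤ x i j := by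
      rw [Filter.eventually_all]
      intro i
      rw [Filter.eventually_all]
      intro j
      rcases (hx.1.1 i j).eq_or_lt with h | h
      · simp [hcx' i j h.symm, ← h]
      · have hlim : Filter.Tendsto (fun t : ℝ => t * |c i j|) (nhdsWithin 0 (Set.Ioi 0))
            (nhds (0 * |c i j|)) :=
          ((continuous_id.mul continuous_const).tendsto 0).mono_left nhdsWithin_le_nhds
        rw [zero_mul] at hlim
        exact (hlim.eventually (gt_mem_nhds h)).mono fun _ => le_of_lt
    obtain ⟨t, h1, h2⟩ := (key.and self_mem_nhdsWithin).exists
    exact ⟨t, h2, h1⟩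
  have hcA : SupportedOn A c := fun i j hij => hcx' i j (hx.1.2.1 i j hij)
  have hp : x + t • c ∈ flowPolytope n A b :=
    add_smul_mem_flowPolytope hx.1 hc hcA fun i j => by
      have := hle i j
      have := mul_le_mul_of_nonneg_left (neg_abs_le (c i j)) ht.le
      linarith
  have hm : x + (-t) • c ∈ flowPolytope n A b :=
    add_smul_mem_flowPolytope hx.1 hc hcA fun i j => by
      have := hle i j
      have := mul_le_mul_of_nonneg_left (le_abs_self (c i j)) ht.le
      linarith
  have h := hx.2 hp hm ⟨1 / 2, 1 / 2, by norm_num, by norm_num, by norm_num, by module⟩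
  rw [add_eq_left] at h
  simpa [ht.ne'] using h

/-- In an acyclic directed graph, a nonzero circulation takes a negative value. -/
theorem exists_neg_of_isCirculation (hacyc : ∀ ij ∈ A, (ij.2 : ℕ) < (ij.1 : ℕ))
    (hc : IsCirculation c) (hcA : SupportedOn A c) (hne : c ≠ 0) : ∃ i j, c i j < 0 := by
  by_contra! hpos
  have hsum : ∑ i : Fin n, ∑ j : Fin n, ((i : ℝ) - (j : ℝ)) * c i j = 0 := by
    have h1 : ∑ i : Fin n, (i : ℝ) * ((∑ j, c i j) - ∑ j, c j i) = 0 :=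
      Finset.sum_eq_zero fun i _ => by rw [hc i, mul_zero]
    have h2 : ∑ i : Fin n, ∑ j : Fin n, (i : ℝ) * c j i
        = ∑ i : Fin n, ∑ j : Fin n, (j : ℝ) * c i j := Finset.sum_comm
    simp only [mul_sub, Finset.sum_sub_distrib, Finset.mul_sum, sub_mul] at h1 ⊢
    rw [← h2]
    exact h1
  have hterm : ∀ i j : Fin n, 0 ≤ ((i : ℝ) - (j : ℝ)) * c i j := by
    intro i j
    by_cases hij : (i, j) ∈ A
    · have : (j : ℝ) < (i : ℝ) := by exact_mod_cast hacyc _ hij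
      exact mul_nonneg (by linarith) (hpos i j)
    · simp [hcA i j hij]
  apply hne
  funext i j
  by_cases hij : (i, j) ∈ A
  · have h1 := (Finset.sum_eq_zero_iff_of_nonneg fun i _ =>
      Finset.sum_nonneg fun j _ => hterm i j).1 hsum i (Finset.mem_univ i)
    have h2 := (Finset.sum_eq_zero_iff_of_nonneg fun j _ => hterm i j).1 h1 j (Finset.mem_univ j)
    have : (j : ℝ) < (i : ℝ) := by exact_mod_cast hacyc _ hij
    exact (mul_eq_zero.1 h2).resolve_left (by linarith)
  · exact hcA i j hij

/-- A feasible forest for the flow polytope together with the flow it carries. -/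
structure IsFeasibleForest (A : Set (Fin n × Fin n)) (b : Fin n → ℝ) (F : Set (Fin n × Fin n))
    (x : Fin n → Fin n → ℝ) : Prop where
  subset : F ⊆ A
  isForest : IsForest F
  mem : x ∈ flowPolytope n A b
  supportedOn : SupportedOn F x

/-- A pivot of the network simplex method along a given circulation. -/
theorem IsFeasibleForest.exists_pivot_of_circulation
    (hacyc : ∀ ij ∈ A, (ij.2 : ℕ) < (ij.1 : ℕ)) (h : IsFeasibleForest A b F x)
    {e : Fin n × Fin n} (heA : e ∈ A) (heF : e ∉ F) (hc : IsCirculation c)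
    (hcF : SupportedOn (insert e F) c) (hce : c e.1 e.2 = 1) :
    ∃ f ∈ F, c f.1 f.2 < 0 ∧ ∃ y, IsFeasibleForest A b (insert e F \ {f}) y ∧
      ∃ w : (polyGraph (flowPolytope n A b)).Walk x y, w.length ≤ 1 := by
  have hFA : insert e F ⊆ A := Set.insert_subset heA h.subset
  have hcA : SupportedOn A c := fun i j hij => hcF i j fun h' => hij (hFA h')
  have hmult : ∀ d, IsCirculation d → SupportedOn (insert e F) d → d = d e.1 e.2 • c := by
    intro d hd hdF
    refine sub_eq_zero.1 (h.isForest _ (hd.sub (hc.smul _)) fun i j hij => ?_)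
    by_cases hije : (i, j) = e
    · subst hije
      simp [hce]
    · have : (i, j) ∉ insert e F := by simp [hije, hij]
      simp [hdF i j this, hcF i j this]
  have hne : c ≠ 0 := by
    rintro rfl
    simp at hce
  obtain ⟨i₀, j₀, hneg⟩ := exists_neg_of_isCirculation hacyc hc hcA hne
  obtain ⟨f, hf, hmin⟩ := Finset.exists_min_image
    (Finset.univ.filter fun a : Fin n × Fin n => c a.1 a.2 < 0)
    (fun a => x a.1 a.2 / -c a.1 a.2) ⟨(i₀, j₀), by simpa using hneg⟩
  simp only [Finset.mem_filter, Finset.mem_univ, true_and] at hf hmin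
  have hfF : f ∈ F := by
    by_contra hfF
    by_cases hfe : f = e
    · subst hfe
      linarith
    · exact hf.ne (hcF f.1 f.2 (by simp [hfe, hfF]))
  set t := x f.1 f.2 / -c f.1 f.2 with ht
  have ht0 : 0 ≤ t := div_nonneg (h.mem.1 _ _) (by linarith)
  have hyf : x f.1 f.2 + t * c f.1 f.2 = 0 := by
    rw [ht]
    field_simp [hf.ne]
    ring
  have hy : x + t • c ∈ flowPolytope n A b := by
    refine add_smul_mem_flowPolytope h.mem hc hcA fun i j => ?_
    rcases lt_or_ge (c i j) 0 with hn | hn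
    · have := hmin (i, j) hn
      rw [le_div_iff₀ (by simpa using hn)] at this
      simp only at this
      linarith
    · exact add_nonneg (h.mem.1 i j) (mul_nonneg ht0 hn)
  have hxe : x e.1 e.2 = 0 := h.supportedOn _ _ heF
  have hforest : IsForest (insert e F \ {f}) := by
    intro d hd hdF
    have h1 := hmult d hd fun i j hij => hdF i j fun h' => hij h'.1
    have h2 : d f.1 f.2 = 0 := hdF _ _ (by simp)
    rw [h1] at h2
    simp only [Pi.smul_apply, smul_eq_mul, mul_eq_zero, hf.ne, or_false] at h2
    rw [h1, h2, zero_smul]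
  have hxF' : SupportedOn (insert e F) x := fun i j hij =>
    h.supportedOn i j fun h' => hij (Set.mem_insert_of_mem _ h')
  have hyF' : SupportedOn (insert e F) (x + t • c) := fun i j hij => by
    simp [hxF' i j hij, hcF i j hij]
  have hyF : SupportedOn (insert e F \ {f}) (x + t • c) := by
    intro i j hij
    by_cases hijf : (i, j) = f
    · subst hijf
      simpa using hyf
    · exact hyF' i j fun h' => hij ⟨h', hijf⟩
  refine ⟨f, hfF, hf, x + t • c, ⟨Set.sdiff_subset.trans hFA, hforest, hy, hyF⟩, ?_⟩
  rcases ht0.eq_or_lt with h0 | h0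
  · rw [← h0, zero_smul, add_zero]
    exact ⟨.nil, by simp⟩
  · have hadj : (polyGraph (flowPolytope n A b)).Adj x (x + t • c) := by
      refine ⟨?_, mem_extremePoints_of_isForest h.isForest h.mem h.supportedOn,
        mem_extremePoints_of_isForest hforest hy hyF, ?_, ?_⟩
      · intro heq
        rw [left_eq_add] at heq
        exact hne ((smul_eq_zero.1 heq).resolve_left h0.ne')
      · rintro z ⟨p, q, hp, hq, hpq, rfl⟩
        have hz : p • x + q • (x + t • c) = x + (q * t) • c := by
          rw [smul_add, ← add_assoc, ← add_smul, hpq, one_smul, smul_smul]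
        rw [hz]
        refine add_smul_mem_flowPolytope h.mem hc hcA fun i j => ?_
        have h1 := mul_nonneg hp (h.mem.1 i j)
        have h2 := mul_nonneg hq (hy.1 i j)
        simp only [Pi.add_apply, Pi.smul_apply, smul_eq_mul] at h2
        have h3 : x i j = p * x i j + q * x i j := by rw [← add_mul, hpq, one_mul]
        linarith
      · intro u hu v hv z hz huv
        have hzF : SupportedOn (insert e F) z := by
          obtain ⟨p, q, -, -, -, rfl⟩ := hz
          intro i j hij
          simp only [Pi.add_apply, Pi.smul_apply, smul_eq_mul, hxF' i j hij, hcF i j hij]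
          ring
        have huF : SupportedOn (insert e F) u := fun i j hij =>
          eq_zero_of_mem_openSegment hu hv huv (hzF i j hij)
        have h1 := hmult (u - x) (isCirculation_sub_of_mem hu h.mem) fun i j hij => by
          simp [huF i j hij, hxF' i j hij]
        have h2 : u = x + u e.1 e.2 • c := by
          rw [← sub_eq_iff_eq_add', h1]
          simp [hxe]
        have hle : u e.1 e.2 ≤ t := by
          have h3 : u f.1 f.2 = x f.1 f.2 + u e.1 e.2 * c f.1 f.2 := congrFun₂ h2 f.1 f.2
          have h4 := hu.1 f.1 f.2
          rw [ht, le_div_iff₀ (by simpa using hf)]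
          linarith
        refine ⟨1 - u e.1 e.2 / t, u e.1 e.2 / t, ?_, div_nonneg (hu.1 _ _) ht0, by ring, ?_⟩
        · rw [sub_nonneg, div_le_one h0]
          exact hle
        · conv_rhs => rw [h2]
          rw [smul_add, ← add_assoc, ← add_smul, sub_add_cancel, one_smul, smul_smul,
            div_mul_cancel₀ _ h0.ne']
    exact ⟨hadj.toWalk, by simp⟩

/-- Any arc can be brought into a feasible forest by at most one step in the graph. -/
theorem IsFeasibleForest.exists_pivot
    (hacyc : ∀ ij ∈ A, (ij.2 : ℕ) < (ij.1 : ℕ)) (h : IsFeasibleForest A b F x)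
    {e : Fin n × Fin n} (heA : e ∈ A) :
    ∃ G y, G ⊆ insert e F ∧ e ∈ G ∧ IsFeasibleForest A b G y ∧
      ∃ w : (polyGraph (flowPolytope n A b)).Walk x y, w.length ≤ 1 := by
  by_cases heF : e ∈ F
  · exact ⟨F, x, Set.subset_insert _ _, heF, h, .nil, by simp⟩
  by_cases hG : IsForest (insert e F)
  · exact ⟨insert e F, x, subset_rfl, Set.mem_insert _ _, ⟨Set.insert_subset heA h.subset, hG, h.mem,
      fun i j hij => h.supportedOn i j fun h' => hij (Set.mem_insert_of_mem _ h')⟩, .nil, by simp⟩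
  unfold IsForest at hG
  push Not at hG
  obtain ⟨c, hc, hcF, hne⟩ := hG
  have hce : c e.1 e.2 ≠ 0 := by
    intro h0
    refine hne (h.isForest c hc fun i j hij => ?_)
    by_cases hije : (i, j) = e
    · subst hije
      exact h0
    · exact hcF i j (by simp [hije, hij])
  obtain ⟨f, hfF, -, y, hy, hw⟩ := h.exists_pivot_of_circulation hacyc heA heF
    (hc.smul (c e.1 e.2)⁻¹) (fun i j hij => by simp [hcF i j hij]) (by simp [hce])
  refine ⟨_, y, Set.sdiff_subset, ⟨Set.mem_insert _ _, ?_⟩, hy, hw⟩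
  rintro rfl
  exact heF hfF

/-- The circulation sending one unit along `j → k → i` and back along the arc `j → i`. -/
def triangle (j k i : Fin n) : Fin n → Fin n → ℝ := fun p q =>
  (if p = j ∧ q = k then 1 else 0) + (if p = k ∧ q = i then 1 else 0)
    - (if p = j ∧ q = i then 1 else 0)

theorem isCirculation_triangle (j k i : Fin n) : IsCirculation (triangle j k i) := by
  intro p
  simp only [triangle, Finset.sum_add_distrib, Finset.sum_sub_distrib, ite_and,
    Finset.sum_ite_eq', Finset.sum_ite_irrel, Finset.sum_const_zero, Finset.mem_univ, if_true]
  ring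

/-- The arc `j → i` is replaced by `j → k` in a feasible forest containing `k → i`. -/
theorem IsFeasibleForest.exists_pivot_triangle
    (hacyc : ∀ ij ∈ A, (ij.2 : ℕ) < (ij.1 : ℕ)) (h : IsFeasibleForest A b F x)
    {j k i : Fin n} (hji : (j, i) ∈ F) (hki : (k, i) ∈ F) (hjk : (j, k) ∈ A) :
    ∃ y, IsFeasibleForest A b (insert (j, k) F \ {(j, i)}) y ∧
      ∃ w : (polyGraph (flowPolytope n A b)).Walk x y, w.length ≤ 1 := by
  have hkj : k ≠ j := fun h' => by simpa [h'] using hacyc _ hjk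
  have hik : i ≠ k := fun h' => by simpa [h'] using hacyc _ (h.subset hki)
  have hval : triangle j k i j k = 1 := by simp [triangle, hkj.symm, hik.symm]
  have hsupp : SupportedOn (insert (j, k) F) (triangle j k i) := by
    intro p q hpq
    have h1 : ¬(p = j ∧ q = k) := by rintro ⟨rfl, rfl⟩; simp at hpq
    have h2 : ¬(p = k ∧ q = i) := by rintro ⟨rfl, rfl⟩; simp [hki] at hpq
    have h3 : ¬(p = j ∧ q = i) := by rintro ⟨rfl, rfl⟩; simp [hji] at hpq
    simp [triangle, h1, h2, h3]
  have hjkF : (j, k) ∉ F := by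
    intro hmem
    rw [Set.insert_eq_of_mem hmem] at hsupp
    simp [h.isForest _ (isCirculation_triangle j k i) hsupp] at hval
  obtain ⟨⟨p, q⟩, -, hneg, hy⟩ := h.exists_pivot_of_circulation hacyc hjk hjkF
    (isCirculation_triangle j k i) hsupp hval
  have hpq : p = j ∧ q = i := by
    by_contra hpq
    simp only [triangle, hpq, if_false] at hneg
    split_ifs at hneg <;> norm_num at hneg
  rwa [hpq.1, hpq.2] at hy

/-- All arcs of `F` into the nodes below `i` are consecutive. -/
def ConsecutiveBelow (i : ℕ) (F : Set (Fin n × Fin n)) : Prop :=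
  ∀ p q : Fin n, (p, q) ∈ F → (q : ℕ) < i → (p : ℕ) = q + 1

theorem IsFeasibleForest.exists_consecutive_into
    (hacyc : ∀ ij ∈ A, (ij.2 : ℕ) < (ij.1 : ℕ))
    (hconsec : ∀ (i : Fin n) (h : (i : ℕ) + 1 < n), (⟨(i : ℕ) + 1, h⟩, i) ∈ A)
    (hinter : ∀ j i : Fin n, (j, i) ∈ A → ∀ h2 : (i : ℕ) + 1 < (j : ℕ),
      (j, (⟨(i : ℕ) + 1, h2.trans j.isLt⟩ : Fin n)) ∈ A)
    (h : IsFeasibleForest A b F x) (i : Fin n) (hi : (i : ℕ) + 1 < n)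
    (hF : ConsecutiveBelow i F) (m : ℕ) (him : (i : ℕ) + 2 ≤ m) (hmn : m ≤ n) :
    ∃ G y, IsFeasibleForest A b G y ∧ ConsecutiveBelow i G ∧
      (⟨(i : ℕ) + 1, hi⟩, i) ∈ G ∧ (∀ p : Fin n, (p, i) ∈ G → (p : ℕ) < m → (p : ℕ) = i + 1) ∧
      ∃ w : (polyGraph (flowPolytope n A b)).Walk x y,
        w.length ≤ {a ∈ A | a.2 = i ∧ (a.1 : ℕ) < m}.ncard := by
  induction m, him using Nat.le_induction with
  | base =>
    obtain ⟨G, y, hGF, heG, hy, w, hw⟩ := h.exists_pivot hacyc (hconsec i hi)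
    refine ⟨G, y, hy, ?_, heG, ?_, w, hw.trans ?_⟩
    · intro p q hpq hqi
      rcases hGF hpq with h' | h'
      · obtain ⟨rfl, rfl⟩ := Prod.mk.inj h'
        rfl
      · exact hF p q h' hqi
    · intro p hp hpm
      have : (i : ℕ) < p := hacyc _ (hy.subset hp)
      omega
    · rw [Nat.one_le_iff_ne_zero, ← Nat.pos_iff_ne_zero, Set.ncard_pos (Set.toFinite _)]
      exact ⟨_, hconsec i hi, rfl, by simp⟩
  | succ m him ih =>
    obtain ⟨G, y, hy, hG, heG, hGi, w, hw⟩ := ih (by omega)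
    let j : Fin n := ⟨m, by omega⟩
    by_cases hj : (j, i) ∈ G
    · have hjA := hy.subset hj
      have hlt : (i : ℕ) + 1 < (j : ℕ) := by simp only [j]; omega
      obtain ⟨z, hz, w', hw'⟩ := hy.exists_pivot_triangle hacyc hj heG (hinter j i hjA hlt)
      refine ⟨_, z, hz, ?_, ?_, ?_, w.append w', ?_⟩
      · rintro p q ⟨hpq | hpq, -⟩ hqi
        · obtain ⟨rfl, rfl⟩ := Prod.mk.inj hpq
          simp at hqi
        · exact hG p q hpq hqi
      · refine ⟨Set.mem_insert_of_mem _ heG, fun h' => ?_⟩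
        have := congrArg (fun a : Fin n × Fin n => (a.1 : ℕ)) h'
        simp only at this
        omega
      · rintro p ⟨hp | hp, hpj⟩ hpm
        · have := congrArg (fun a : Fin n × Fin n => (a.2 : ℕ)) hp
          simp at this
        · refine hGi p hp ?_
          have : (p : ℕ) ≠ m := fun hpm' => hpj (by
            have : p = j := Fin.ext hpm'
            simp [this])
          omega
      · have hins : insert (j, i) {a ∈ A | a.2 = i ∧ (a.1 : ℕ) < m} ⊆
            {a ∈ A | a.2 = i ∧ (a.1 : ℕ) < m + 1} := by
          rintro a (rfl | ⟨h1, h2, h3⟩)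
          · exact ⟨hjA, rfl, by simp [j]⟩
          · exact ⟨h1, h2, by omega⟩
        have hcard := Set.ncard_le_ncard hins (Set.toFinite _)
        rw [Set.ncard_insert_of_notMem (by simp [j]) (Set.toFinite _)] at hcard
        rw [SimpleGraph.Walk.length_append]
        omega
    · refine ⟨G, y, hy, hG, heG, fun p hp hpm => hGi p hp ?_, w, hw.trans ?_⟩
      · have : (p : ℕ) ≠ m := fun hpm' => hj (by
          have : p = j := Fin.ext hpm'
          rwa [← this])
        omega
      · exact Set.ncard_le_ncard (fun a ha => ⟨ha.1, ha.2.1, ha.2.2.trans (Nat.lt_succ_self m)⟩)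
          (Set.toFinite _)

theorem IsFeasibleForest.exists_consecutiveBelow
    (hacyc : ∀ ij ∈ A, (ij.2 : ℕ) < (ij.1 : ℕ))
    (hconsec : ∀ (i : Fin n) (h : (i : ℕ) + 1 < n), (⟨(i : ℕ) + 1, h⟩, i) ∈ A)
    (hinter : ∀ j i : Fin n, (j, i) ∈ A → ∀ h2 : (i : ℕ) + 1 < (j : ℕ),
      (j, (⟨(i : ℕ) + 1, h2.trans j.isLt⟩ : Fin n)) ∈ A)
    (h : IsFeasibleForest A b F x) (i : ℕ) (hi : i ≤ n) :
    ∃ G y, IsFeasibleForest A b G y ∧ ConsecutiveBelow i G ∧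
      ∃ w : (polyGraph (flowPolytope n A b)).Walk x y,
        w.length ≤ {a ∈ A | (a.2 : ℕ) < i}.ncard := by
  induction i with
  | zero => exact ⟨F, x, h, fun _ _ _ hq => by simp at hq, .nil, by simp⟩
  | succ i ih =>
    obtain ⟨G, y, hy, hG, w, hw⟩ := ih (by omega)
    let k : Fin n := ⟨i, by omega⟩
    rcases (Nat.succ_le_of_lt hi).eq_or_lt with hin | hin
    · refine ⟨G, y, hy, fun p q hpq hqi => ?_, w, hw.trans ?_⟩
      · have : (q : ℕ) < p := hacyc _ (hy.subset hpq)
        exact hG p q hpq (by omega)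
      · exact Set.ncard_le_ncard (fun a ha => ⟨ha.1, ha.2.trans (Nat.lt_succ_self i)⟩)
          (Set.toFinite _)
    · obtain ⟨G', z, hz, hG', -, hGk, w', hw'⟩ :=
        hy.exists_consecutive_into hacyc hconsec hinter k hin hG n hin le_rfl
      refine ⟨G', z, hz, fun p q hpq hqi => ?_, w.append w', ?_⟩
      · rcases (Nat.lt_succ_iff.1 hqi).eq_or_lt with hq | hq
        · have : q = k := Fin.ext hq
          subst this
          exact hGk p hpq p.isLt
        · exact hG' p q hpq hq
      · have hdisj : Disjoint {a ∈ A | (a.2 : ℕ) < i} {a ∈ A | a.2 = k ∧ (a.1 : ℕ) < n} := by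
          rw [Set.disjoint_left]
          rintro a ⟨-, h1⟩ ⟨-, h2, -⟩
          simp [h2, k] at h1
        have hsub : {a ∈ A | (a.2 : ℕ) < i} ∪ {a ∈ A | a.2 = k ∧ (a.1 : ℕ) < n} ⊆
            {a ∈ A | (a.2 : ℕ) < i + 1} := by
          rintro a (⟨h1, h2⟩ | ⟨h1, h2, -⟩)
          · exact ⟨h1, h2.trans (Nat.lt_succ_self i)⟩
          · exact ⟨h1, by simp [h2, k]⟩
        have hcard := Set.ncard_le_ncard hsub (Set.toFinite _)
        rw [Set.ncard_union_eq hdisj (Set.toFinite _) (Set.toFinite _)] at hcard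
        rw [SimpleGraph.Walk.length_append]
        omega

/-- The arcs between consecutive nodes form a forest. -/
theorem isForest_consecutive :
    IsForest {a : Fin n × Fin n | (a.1 : ℕ) = a.2 + 1} := by
  intro c hc hcF
  have hzero : ∀ (k : ℕ) (p q : Fin n), (q : ℕ) = k → c p q = 0 := by
    intro k
    induction k with
    | zero =>
      intro p q hq
      by_cases hpq : (p : ℕ) = q + 1
      · have h := hc q
        rw [Finset.sum_eq_zero fun r _ => hcF q r fun h' => by simp at h'; omega,
          Finset.sum_eq_single p (fun r _ hr => hcF r q fun h' => hr (Fin.ext (h'.trans hpq.symm)))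
            (by simp)] at h
        linarith
      · exact hcF p q hpq
    | succ k ih =>
      intro p q hq
      by_cases hpq : (p : ℕ) = q + 1
      · have h := hc q
        have hout : ∀ r, c q r = 0 := fun r => by
          by_cases hr : (r : ℕ) = k
          · exact ih q r hr
          · exact hcF q r fun h' => hr (by simp at h'; omega)
        rw [Finset.sum_eq_zero fun r _ => hout r,
          Finset.sum_eq_single p (fun r _ hr => hcF r q fun h' => hr (Fin.ext (h'.trans hpq.symm)))
            (by simp)] at h
        linarith
      · exact hcF p q hpq
  funext p q
  exact hzero q p q rfl

theorem exists_walk_supportedOn_consecutive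
    (hacyc : ∀ ij ∈ A, (ij.2 : ℕ) < (ij.1 : ℕ))
    (hconsec : ∀ (i : Fin n) (h : (i : ℕ) + 1 < n), (⟨(i : ℕ) + 1, h⟩, i) ∈ A)
    (hinter : ∀ j i : Fin n, (j, i) ∈ A → ∀ h2 : (i : ℕ) + 1 < (j : ℕ),
      (j, (⟨(i : ℕ) + 1, h2.trans j.isLt⟩ : Fin n)) ∈ A)
    (hx : x ∈ Set.extremePoints ℝ (flowPolytope n A b)) :
    ∃ y ∈ flowPolytope n A b, SupportedOn {a : Fin n × Fin n | (a.1 : ℕ) = a.2 + 1} y ∧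
      ∃ w : (polyGraph (flowPolytope n A b)).Walk x y, w.length ≤ A.ncard := by
  have h : IsFeasibleForest A b {a | x a.1 a.2 ≠ 0} x :=
    ⟨fun a ha => by_contra fun h' => ha (hx.1.2.1 a.1 a.2 h'),
      isForest_support_of_mem_extremePoints hx, hx.1, fun i j hij => by simpa using hij⟩
  obtain ⟨G, y, hy, hG, w, hw⟩ := h.exists_consecutiveBelow hacyc hconsec hinter n le_rfl
  refine ⟨y, hy.mem, fun i j hij => hy.supportedOn i j fun h' => hij (hG i j h' j.isLt), w,
    hw.trans (Set.ncard_le_ncard (fun a ha => ha.1) (Set.toFinite _))⟩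

end

/-- If the arc set `A` has the intermediate property, then the diameter of the corresponding
singly-capacitated network flow polytope is at most twice the number of arcs. -/
theorem flowPolytope_intermediate_diameter_le
    (n : ℕ) (hn : 2 ≤ n) (A : Set (Fin n × Fin n))
    (hacyc : ∀ ij ∈ A, (ij.2 : ℕ) < (ij.1 : ℕ))
    (hconsec : ∀ (i : Fin n) (h : (i : ℕ) + 1 < n), (⟨(i : ℕ) + 1, h⟩, i) ∈ A)
    (hinter : ∀ j i : Fin n, (j, i) ∈ A → ∀ h2 : (i : ℕ) + 1 < (j : ℕ),
      (j, (⟨(i : ℕ) + 1, h2.trans j.isLt⟩ : Fin n)) ∈ A)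
    (b : Fin n → ℝ) :
    ∀ a ∈ Set.extremePoints ℝ (flowPolytope n A b),
      ∀ c ∈ Set.extremePoints ℝ (flowPolytope n A b),
        ∃ L ≤ 2 * A.ncard, HasPathOfLength (flowPolytope n A b) a c L := by
  intro a ha c hc
  obtain ⟨y, hy, hyF, w, hw⟩ := exists_walk_supportedOn_consecutive hacyc hconsec hinter ha
  obtain ⟨z, hz, hzF, w', hw'⟩ := exists_walk_supportedOn_consecutive hacyc hconsec hinter hc
  obtain rfl : y = z := sub_eq_zero.1 <|
    isForest_consecutive _ (isCirculation_sub_of_mem hy hz) fun i j hij => by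
      simp [hyF i j hij, hzF i j hij]
  refine ⟨_, ?_, hasPathOfLength_of_walk (w.append w'.reverse)⟩
  rw [SimpleGraph.Walk.length_append, SimpleGraph.Walk.length_reverse]
  omega
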